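/- There exist a completely regular topological space X and a subspace E ⊆ X such that E is 1-embedded in X but E is not 0-embedded in X. -/

import Mathlib

open Set

universe u v

/-- `A` is functionally open in `X`: `A = f⁻¹((0,1])` for some continuous `f : X → [0,1]`. -/
def FunctionallyOpen (X : Type u) [TopologicalSpace X] (A : Set X) : Prop :=
  ∃ f : X → ℝ, Continuous f ∧ (∀ x, f x ∈ Set.Icc (0:ℝ) 1) ∧ A = f ⁻¹' (Set.Ioc 0 1)

/-- `A` is functionally closed in `X`: `A = f⁻¹(0)` for some continuous `f : X → [0,1]`. -/
def FunctionallyClosed (X : Type u) [TopologicalSpace X] (A : Set X) : Prop :=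
  ∃ f : X → ℝ, Continuous f ∧ (∀ x, f x ∈ Set.Icc (0:ℝ) 1) ∧ A = f ⁻¹' {0}

mutual
/-- The `α`'th functionally additive class in `X`. -/
inductive FunAdd (X : Type u) [TopologicalSpace X] : Ordinal.{0} → Set X → Prop where
  | base (A : Set X) : FunctionallyOpen X A → FunAdd X 0 A
  | union (α : Ordinal.{0}) (hα : α ≠ 0) (β : ℕ → Ordinal.{0}) (hβ : ∀ n, β n < α)
      (s : ℕ → Set X) (hs : ∀ n, FunMul X (β n) (s n)) : FunAdd X α (⋃ n, s n)

/-- The `α`'th functionally multiplicative class in `X`. -/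
inductive FunMul (X : Type u) [TopologicalSpace X] : Ordinal.{0} → Set X → Prop where
  | base (A : Set X) : FunctionallyClosed X A → FunMul X 0 A
  | inter (α : Ordinal.{0}) (hα : α ≠ 0) (β : ℕ → Ordinal.{0}) (hβ : ∀ n, β n < α)
      (s : ℕ → Set X) (hs : ∀ n, FunAdd X (β n) (s n)) : FunMul X α (⋂ n, s n)
end

mutual
/-- The `α`'th (ordinary) additive Borel class in `X`. -/
inductive BorelAdd (X : Type u) [TopologicalSpace X] : Ordinal.{0} → Set X → Prop where
  | base (A : Set X) : IsOpen A → BorelAdd X 0 A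
  | union (α : Ordinal.{0}) (hα : α ≠ 0) (β : ℕ → Ordinal.{0}) (hβ : ∀ n, β n < α)
      (s : ℕ → Set X) (hs : ∀ n, BorelMul X (β n) (s n)) : BorelAdd X α (⋃ n, s n)

/-- The `α`'th (ordinary) multiplicative Borel class in `X`. -/
inductive BorelMul (X : Type u) [TopologicalSpace X] : Ordinal.{0} → Set X → Prop where
  | base (A : Set X) : IsClosed A → BorelMul X 0 A
  | inter (α : Ordinal.{0}) (hα : α ≠ 0) (β : ℕ → Ordinal.{0}) (hβ : ∀ n, β n < α)
      (s : ℕ → Set X) (hs : ∀ n, BorelAdd X (β n) (s n)) : BorelMul X α (⋂ n, s n)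
end

/-- A set is functionally ambiguous of class `α` if it belongs to both the `α`'th functionally
additive and the `α`'th functionally multiplicative class. -/
def FunAmbiguous (X : Type u) [TopologicalSpace X] (α : Ordinal.{0}) (A : Set X) : Prop :=
  FunAdd X α A ∧ FunMul X α A

/-- `f ∈ K_α(X,Y)`: for `α = 0` continuity, for `α > 0` preimages of open sets belong to
the `α`'th functionally additive class. -/
def KClass {X : Type u} {Y : Type v} [TopologicalSpace X] [TopologicalSpace Y]
    (α : Ordinal.{0}) (f : X → Y) : Prop :=
  (α = 0 → Continuous f) ∧ (α ≠ 0 → ∀ V : Set Y, IsOpen V → FunAdd X α (f ⁻¹' V))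

/-- `A` and `B` are `α`-separated in `X`. -/
def AlphaSeparated {X : Type u} [TopologicalSpace X] (α : Ordinal.{0}) (A B : Set X) : Prop :=
  ∃ f : X → ℝ, KClass α f ∧ A ⊆ f ⁻¹' {0} ∧ B ⊆ f ⁻¹' {1}

/-- `X` is an `α`-separated space: any two disjoint sets of the `α`'th (ordinary)
multiplicative class are `α`-separated. -/
def AlphaSeparatedSpace (X : Type u) [TopologicalSpace X] (α : Ordinal.{0}) : Prop :=
  ∀ A B : Set X, BorelMul X α A → BorelMul X α B → Disjoint A B → AlphaSeparated α A B

/-- `E` is `α`-embedded in `X`. -/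
def AlphaEmbedded {X : Type u} [TopologicalSpace X] (α : Ordinal.{0}) (E : Set X) : Prop :=
  (∀ A : Set ↥E, FunAdd ↥E α A → ∃ B : Set X, FunAdd X α B ∧ Subtype.val '' A = B ∩ E) ∧
  (∀ A : Set ↥E, FunMul ↥E α A → ∃ B : Set X, FunMul X α B ∧ Subtype.val '' A = B ∩ E)

/-- `E` is ambiguously `α`-embedded in `X`. -/
def AmbiguouslyEmbedded {X : Type u} [TopologicalSpace X] (α : Ordinal.{0}) (E : Set X) : Prop :=
  ∀ A : Set ↥E, FunAmbiguous ↥E α A →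
    ∃ B : Set X, FunAmbiguous X α B ∧ Subtype.val '' A = B ∩ E

/-- The first uncountable ordinal. -/
noncomputable def omega1 : Ordinal.{0} := (Cardinal.aleph 1).ord

/-- `A` is an `F_σ`-set: a countable union of closed sets. -/
def IsFSigma {X : Type u} [TopologicalSpace X] (A : Set X) : Prop :=
  ∃ F : ℕ → Set X, (∀ n, IsClosed (F n)) ∧ A = ⋃ n, F n

/-- A space has a countable π-base. -/
def CountablePiBase (Z : Type v) [TopologicalSpace Z] : Prop :=
  ∃ 𝒰 : Set (Set Z), 𝒰.Countable ∧ (∀ U ∈ 𝒰, IsOpen U ∧ U.Nonempty) ∧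
    ∀ V : Set Z, IsOpen V → V.Nonempty → ∃ U ∈ 𝒰, U ⊆ V

lemma fc_of_cont {X : Type u} [TopologicalSpace X] {g : X → ℝ} (hg : Continuous g) :
    FunctionallyClosed X (g ⁻¹' {0}) := by
  refine ⟨fun x => min |g x| 1, by fun_prop, fun x => ⟨by positivity, min_le_right _ _⟩, ?_⟩
  ext x
  simp only [mem_preimage, mem_singleton_iff]
  constructor
  · intro h; simp [h]
  · intro h
    rcases min_choice |g x| 1 with h' | h'
    · rw [h'] at h; exact abs_eq_zero.1 h
    · rw [h'] at h; norm_num at h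

lemma funAdd_zero {X : Type u} [TopologicalSpace X] {α : Ordinal.{0}} {A : Set X}
    (h : FunAdd X α A) (hα : α = 0) : FunctionallyOpen X A := by
  cases h with
  | base A h => exact h
  | union α h0 => exact absurd hα h0

lemma funMul_zero {X : Type u} [TopologicalSpace X] {α : Ordinal.{0}} {A : Set X}
    (h : FunMul X α A) (hα : α = 0) : FunctionallyClosed X A := by
  cases h with
  | base A h => exact h
  | inter α h0 => exact absurd hα h0

lemma fo_compl {X : Type u} [TopologicalSpace X] {A : Set X} (h : FunctionallyOpen X A) :
    FunctionallyClosed X Aᶜ := by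
  obtain ⟨f, hf, h01, rfl⟩ := h
  refine ⟨f, hf, h01, ?_⟩
  ext x
  have := h01 x
  simp only [mem_compl_iff, mem_preimage, mem_Ioc, mem_singleton_iff, mem_Icc] at *
  constructor
  · intro h; by_contra h'
    exact h ⟨lt_of_le_of_ne this.1 (Ne.symm h'), this.2⟩
  · intro h; simp [h]

lemma fc_compl {X : Type u} [TopologicalSpace X] {A : Set X} (h : FunctionallyClosed X A) :
    FunctionallyOpen X Aᶜ := by
  obtain ⟨f, hf, h01, rfl⟩ := h
  refine ⟨f, hf, h01, ?_⟩
  ext x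
  have := h01 x
  simp only [mem_compl_iff, mem_preimage, mem_Ioc, mem_singleton_iff, mem_Icc] at *
  constructor
  · intro h'
    exact ⟨lt_of_le_of_ne this.1 (Ne.symm h'), this.2⟩
  · intro h; exact h.1.ne'

lemma funAdd_one {X : Type u} [TopologicalSpace X] {A : Set X} :
    FunAdd X 1 A ↔ ∃ s : ℕ → Set X, (∀ n, FunctionallyClosed X (s n)) ∧ A = ⋃ n, s n := by
  constructor
  · intro h
    generalize hα : (1 : Ordinal.{0}) = α at h
    cases h with
    | base A h => exact absurd hα one_ne_zero
    | union α h0 β hβ s hs =>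
      subst hα
      exact ⟨s, fun n => funMul_zero (hs n) (Order.lt_one_iff.1 (hβ n)), rfl⟩
  · rintro ⟨s, hs, rfl⟩
    exact FunAdd.union 1 one_ne_zero (fun _ => 0) (fun _ => zero_lt_one) s
      fun n => FunMul.base _ (hs n)

lemma funMul_one {X : Type u} [TopologicalSpace X] {A : Set X} :
    FunMul X 1 A ↔ ∃ s : ℕ → Set X, (∀ n, FunctionallyOpen X (s n)) ∧ A = ⋂ n, s n := by
  constructor
  · intro h
    generalize hα : (1 : Ordinal.{0}) = α at h
    cases h with
    | base A h => exact absurd hα one_ne_zero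
    | inter α h0 β hβ s hs =>
      subst hα
      exact ⟨s, fun n => funAdd_zero (hs n) (Order.lt_one_iff.1 (hβ n)), rfl⟩
  · rintro ⟨s, hs, rfl⟩
    exact FunMul.inter 1 one_ne_zero (fun _ => 0) (fun _ => zero_lt_one) s
      fun n => FunAdd.base _ (hs n)

lemma funMul_one_compl {X : Type u} [TopologicalSpace X] {A : Set X} (h : FunMul X 1 A) :
    FunAdd X 1 Aᶜ := by
  obtain ⟨s, hs, rfl⟩ := funMul_one.1 h
  exact funAdd_one.2 ⟨fun n => (s n)ᶜ, fun n => fo_compl (hs n), compl_iInter _⟩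

lemma funAdd_one_compl {X : Type u} [TopologicalSpace X] {A : Set X} (h : FunAdd X 1 A) :
    FunMul X 1 Aᶜ := by
  obtain ⟨s, hs, rfl⟩ := funAdd_one.1 h
  exact funMul_one.2 ⟨fun n => (s n)ᶜ, fun n => fc_compl (hs n), compl_iUnion _⟩

lemma funAdd_one_iUnion {X : Type u} [TopologicalSpace X] {ι : Type} [Countable ι] [Nonempty ι]
    {s : ι → Set X} (h : ∀ i, FunAdd X 1 (s i)) : FunAdd X 1 (⋃ i, s i) := by
  choose t ht hst using fun i => funAdd_one.1 (h i)
  obtain ⟨e, he⟩ := exists_surjective_nat (ι × ℕ)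
  refine funAdd_one.2 ⟨fun n => t (e n).1 (e n).2, fun n => ht _ _, ?_⟩
  ext x
  simp only [mem_iUnion, hst]
  constructor
  · rintro ⟨i, j, hx⟩
    obtain ⟨n, hn⟩ := he (i, j)
    exact ⟨n, by simpa [hn] using hx⟩
  · rintro ⟨n, hx⟩
    exact ⟨_, _, hx⟩

/-- a free ultrafilter -/
noncomputable def pp : Ultrafilter ℕ := Filter.hyperfilter ℕ

lemma pure_ne_pp (m : ℕ) : (pure m : Ultrafilter ℕ) ≠ pp := by
  intro h
  have h1 : ({m} : Set ℕ) ∈ (pure m : Ultrafilter ℕ) := by simp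
  rw [h] at h1
  exact Set.Finite.notMem_hyperfilter (Set.finite_singleton m) h1

lemma exists_ne_pp (g : ℕ → Ultrafilter ℕ → ℝ) (hg : ∀ n, Continuous (g n))
    (h0 : ∀ n, g n pp = 0) : ∃ x, x ≠ pp ∧ ∀ n, g n x = 0 := by
  have key : ∀ k N : ℕ, ∃ m, N < m ∧ ∀ i ≤ k, |g i (pure m)| < 1 / ((k : ℝ) + 1) := by
    intro k N
    have h1 : ∀ i, ∀ᶠ m in (pp : Filter ℕ), |g i (pure m)| < 1 / ((k : ℝ) + 1) := by
      intro i
      have ht : Filter.Tendsto (fun m => |g i (pure m)|) (pp : Filter ℕ) (nhds |g i pp|) :=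
        ((hg i).abs.tendsto pp).comp (Ultrafilter.tendsto_pure_self _)
      rw [h0 i, abs_zero] at ht
      exact ht.eventually (gt_mem_nhds (by positivity))
    have h2 : ∀ᶠ m in (pp : Filter ℕ), ∀ i ∈ Finset.range (k + 1),
        |g i (pure m)| < 1 / ((k : ℝ) + 1) := by
      rw [Filter.eventually_all_finset]
      exact fun i _ => h1 i
    have h3 : ∀ᶠ m in (pp : Filter ℕ), N < m := by
      have : (pp : Filter ℕ) ≤ Filter.atTop := by
        rw [← Nat.cofinite_eq_atTop]; exact Filter.hyperfilter_le_cofinite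
      exact this (Filter.eventually_gt_atTop N)
    obtain ⟨m, hm, hm'⟩ := (h3.and h2).exists
    exact ⟨m, hm, fun i hi => hm' i (Finset.mem_range.2 (by omega))⟩
  choose φ hφ1 hφ2 using key
  let a : ℕ → ℕ := fun n => Nat.rec 0 (fun k r => φ k r) n
  have ha : ∀ k, a (k + 1) = φ k (a k) := fun k => rfl
  have hmono : StrictMono a := strictMono_nat_of_lt_succ fun k => by
    rw [ha]; exact hφ1 _ _
  have main : ∀ c : ℕ → ℕ, (∀ k, k ≤ c k) → ∀ n,
      g n ((Filter.hyperfilter ℕ : Ultrafilter ℕ).map (fun k => a (c k + 1))) = 0 := by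
    intro c hc n
    set u := (Filter.hyperfilter ℕ : Ultrafilter ℕ).map (fun k => a (c k + 1))
    have t1 : Filter.Tendsto (fun m => g n (pure m)) (u : Filter ℕ) (nhds (g n u)) :=
      ((hg n).tendsto u).comp (Ultrafilter.tendsto_pure_self _)
    have t2 : Filter.Tendsto (fun k => g n (pure (a (c k + 1))))
        (Filter.hyperfilter ℕ : Filter ℕ) (nhds (g n u)) := by
      simpa [u, Filter.tendsto_map'_iff, Function.comp_def] using t1
    have hle : (Filter.hyperfilter ℕ : Filter ℕ) ≤ Filter.atTop := by
      rw [← Nat.cofinite_eq_atTop]; exact Filter.hyperfilter_le_cofinite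
    have t3 : Filter.Tendsto (fun k => g n (pure (a (c k + 1)))) Filter.atTop (nhds 0) := by
      apply squeeze_zero_norm' _ (tendsto_one_div_add_atTop_nhds_zero_nat (𝕜 := ℝ))
      filter_upwards [Filter.eventually_ge_atTop n] with k hk
      rw [Real.norm_eq_abs, ha]
      refine (hφ2 (c k) _ n (hk.trans (hc k))).le.trans ?_
      have := hc k
      gcongr
    exact tendsto_nhds_unique t2 (t3.mono_left hle)
  by_cases hu : (Filter.hyperfilter ℕ : Ultrafilter ℕ).map (fun k => a (2 * k + 1)) = pp
  · refine ⟨(Filter.hyperfilter ℕ : Ultrafilter ℕ).map (fun k => a (2 * k + 1 + 1)), ?_,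
      main (fun k => 2 * k + 1) (fun k => by omega)⟩
    intro hv
    have h1 : range (fun k => a (2 * k + 1)) ∈ pp := by
      rw [← hu, Ultrafilter.mem_map]; exact Filter.mem_of_superset Filter.univ_mem fun k _ => mem_range_self k
    have h2 : range (fun k => a (2 * k + 1 + 1)) ∈ pp := by
      rw [← hv, Ultrafilter.mem_map]; exact Filter.mem_of_superset Filter.univ_mem fun k _ => mem_range_self k
    obtain ⟨x, ⟨i, hi⟩, ⟨j, hj⟩⟩ := Ultrafilter.nonempty_of_mem (Filter.inter_mem h1 h2)
    have : 2 * i + 1 = 2 * j + 1 + 1 := hmono.injective (hi.trans hj.symm)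
    omega
  · exact ⟨_, hu, main (fun k => 2 * k) (fun k => by omega)⟩

/-- the subspace -/
def EE : Set (Ultrafilter ℕ × ℝ) := {x | (x.1 ≠ pp ∧ x.2 = 0) ∨ (x.1 = pp ∧ x.2 ≠ 0)}

lemma ext_C (f : EE → ℝ) (hf : Continuous f) (h01 : ∀ x, f x ∈ Icc (0:ℝ) 1) :
    ∃ F : Ultrafilter ℕ → ℝ, Continuous F ∧
      ∀ x (hx : x ≠ pp), F x = f ⟨(x, 0), Or.inl ⟨hx, rfl⟩⟩ := by
  let g : ℕ → Icc (0:ℝ) 1 := fun m => ⟨f ⟨(pure m, 0), Or.inl ⟨pure_ne_pp m, rfl⟩⟩, h01 _⟩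
  have hc : Continuous (fun x => ((Ultrafilter.extend g x : Icc (0:ℝ) 1) : ℝ)) :=
    continuous_subtype_val.comp (continuous_ultrafilter_extend g)
  refine ⟨_, hc, fun x hx => ?_⟩
  have t1 : Filter.Tendsto (fun m => ((Ultrafilter.extend g (pure m) : Icc (0:ℝ) 1) : ℝ)) (x : Filter ℕ)
      (nhds ((Ultrafilter.extend g x : Icc (0:ℝ) 1) : ℝ)) :=
    (hc.tendsto x).comp (Ultrafilter.tendsto_pure_self _)
  have t2 : Filter.Tendsto (fun m : ℕ => f ⟨(pure m, 0), Or.inl ⟨pure_ne_pp m, rfl⟩⟩)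
      (x : Filter ℕ) (nhds (f ⟨(x, 0), Or.inl ⟨hx, rfl⟩⟩)) := by
    refine (hf.tendsto _).comp ?_
    rw [tendsto_subtype_rng]
    exact Filter.Tendsto.prodMk_nhds (Ultrafilter.tendsto_pure_self _) tendsto_const_nhds
  refine tendsto_nhds_unique t1 (t2.congr fun m => ?_)
  rw [ultrafilter_extend_pure]

open Classical in
lemma ext_F (f : EE → ℝ) (hf : Continuous f) (h01 : ∀ x, f x ∈ Icc (0:ℝ) 1) :
    ∃ h : ℝ → ℝ, Continuous h ∧
      ∀ t (ht : t ≠ 0), h t = t * f ⟨(pp, t), Or.inr ⟨rfl, ht⟩⟩ := by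
  let h : ℝ → ℝ := fun t => if ht : t ≠ 0 then t * f ⟨(pp, t), Or.inr ⟨rfl, ht⟩⟩ else 0
  have hh : ∀ t (ht : t ≠ 0), h t = t * f ⟨(pp, t), Or.inr ⟨rfl, ht⟩⟩ := fun t ht => dif_pos ht
  refine ⟨h, ?_, hh⟩
  rw [continuous_iff_continuousAt]
  intro t
  by_cases ht : t = 0
  · subst ht
    have h0 : h 0 = 0 := by simp [h]
    rw [ContinuousAt, h0]
    refine squeeze_zero_norm (a := fun t => |t|) (fun t => ?_) ?_
    · by_cases ht : t = 0
      · subst ht; simp [h0]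
      · rw [hh t ht, Real.norm_eq_abs, abs_mul]
        have := h01 ⟨(pp, t), Or.inr ⟨rfl, ht⟩⟩
        rw [abs_of_nonneg this.1]
        exact mul_le_of_le_one_right (abs_nonneg _) this.2
    · simpa using (continuous_abs.tendsto (0:ℝ))
  · have hO : IsOpen {t : ℝ | t ≠ 0} := isOpen_ne
    have : ContinuousOn h {t : ℝ | t ≠ 0} := by
      rw [continuousOn_iff_continuous_domRestrict]
      have : ({t : ℝ | t ≠ 0}).domRestrict h = fun t : {t : ℝ | t ≠ 0} =>
          t.1 * f ⟨(pp, t.1), Or.inr ⟨rfl, t.2⟩⟩ := by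
        ext t; exact hh t.1 t.2
      rw [this]
      refine continuous_subtype_val.mul (hf.comp ?_)
      exact Continuous.subtype_mk (by fun_prop) _
    exact this.continuousAt (hO.mem_nhds ht)

lemma trace_fc (A : Set EE) (hA : FunctionallyClosed EE A) :
    ∃ B : Set (Ultrafilter ℕ × ℝ), FunAdd _ 1 B ∧ Subtype.val '' A = B ∩ EE := by
  obtain ⟨f, hf, h01, rfl⟩ := hA
  obtain ⟨F, hF, hFf⟩ := ext_C f hf h01
  obtain ⟨h, hh, hhf⟩ := ext_F f hf h01
  let s : Option ℕ → Set (Ultrafilter ℕ × ℝ) := fun o => match o with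
    | none => (fun x => |x.2| + |F x.1|) ⁻¹' {0}
    | some j => (fun x => |h x.2| + max 0 (1 / ((j:ℝ) + 1) - |x.2|)) ⁻¹' {0}
  have hs : ∀ o, FunAdd _ 1 (s o) := by
    intro o
    have : FunctionallyClosed _ (s o) := by
      cases o with
      | none => exact fc_of_cont (by fun_prop)
      | some j => exact fc_of_cont (by fun_prop)
    exact funAdd_one.2 ⟨fun _ => s o, fun _ => this, by simp [iUnion_const]⟩
  refine ⟨_, funAdd_one_iUnion hs, ?_⟩
  have e1 : ∀ x, x ∈ s none ↔ x.2 = 0 ∧ F x.1 = 0 := by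
    intro x
    change |x.2| + |F x.1| = 0 ↔ _
    rw [add_eq_zero_iff_of_nonneg (abs_nonneg _) (abs_nonneg _), abs_eq_zero, abs_eq_zero]
  have e2 : ∀ j x, x ∈ s (some j) ↔ h x.2 = 0 ∧ 1 / ((j:ℝ) + 1) ≤ |x.2| := by
    intro j x
    change |h x.2| + max 0 (1 / ((j:ℝ) + 1) - |x.2|) = 0 ↔ _
    rw [add_eq_zero_iff_of_nonneg (abs_nonneg _) (le_max_left _ _), abs_eq_zero,
      max_eq_left_iff, sub_nonpos]
  have e3 : ∀ x : Ultrafilter ℕ × ℝ, x ∈ ⋃ o, s o ↔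
      (x.2 = 0 ∧ F x.1 = 0) ∨ (x.2 ≠ 0 ∧ h x.2 = 0) := by
    intro x
    rw [mem_iUnion, Option.exists, e1]
    refine or_congr Iff.rfl ?_
    simp only [e2]
    constructor
    · rintro ⟨j, h1, h2⟩
      refine ⟨fun h0 => ?_, h1⟩
      rw [h0, abs_zero] at h2
      exact absurd h2 (not_le.2 (by positivity))
    · rintro ⟨h1, h2⟩
      obtain ⟨j, hj⟩ := exists_nat_one_div_lt (abs_pos.2 h1)
      exact ⟨j, h2, hj.le⟩
  ext ⟨x, t⟩
  rw [mem_inter_iff, e3]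
  constructor
  · rintro ⟨⟨⟨x', t'⟩, hE⟩, hA, heq⟩
    obtain ⟨rfl, rfl⟩ := Prod.mk.inj heq
    refine ⟨?_, hE⟩
    have hA : f ⟨(x', t'), hE⟩ = 0 := hA
    rcases hE with ⟨h1, h2⟩ | ⟨h1, h2⟩
    · left
      dsimp only at h1 h2
      subst h2
      exact ⟨rfl, by rw [hFf _ h1]; exact hA⟩
    · right
      dsimp only at h1 h2
      subst h1
      exact ⟨h2, by rw [hhf _ h2, hA, mul_zero]⟩
  · rintro ⟨hB, hE⟩
    refine ⟨⟨(x, t), hE⟩, ?_, rfl⟩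
    change f ⟨(x, t), hE⟩ = 0
    rcases id hE with ⟨h1, h2⟩ | ⟨h1, h2⟩
    · dsimp only at h1 h2
      subst h2
      have := (hB.resolve_right (by simp)).2
      rwa [hFf _ h1] at this
    · dsimp only at h1 h2
      subst h1
      have := (hB.resolve_left (by simp [h2])).2
      rw [hhf _ h2] at this
      exact (mul_eq_zero.1 this).resolve_left h2

lemma trace_add (A : Set EE) (hA : FunAdd EE 1 A) :
    ∃ B : Set (Ultrafilter ℕ × ℝ), FunAdd _ 1 B ∧ Subtype.val '' A = B ∩ EE := by
  obtain ⟨s, hs, rfl⟩ := funAdd_one.1 hA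
  choose B hB hBs using fun n => trace_fc (s n) (hs n)
  exact ⟨_, funAdd_one_iUnion hB, by rw [image_iUnion, iUnion_inter]; simp only [hBs]⟩

lemma trace_mul (A : Set EE) (hA : FunMul EE 1 A) :
    ∃ B : Set (Ultrafilter ℕ × ℝ), FunMul _ 1 B ∧ Subtype.val '' A = B ∩ EE := by
  obtain ⟨B, hB, h⟩ := trace_add Aᶜ (funMul_one_compl hA)
  refine ⟨Bᶜ, funAdd_one_compl hB, ?_⟩
  ext x
  have hx := Set.ext_iff.1 h x
  by_cases hE : x ∈ EE
  · simp [hE] at hx ⊢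
    tauto
  · simp [hE]

lemma not_zero : ¬ AlphaEmbedded 0 EE := by
  intro hE
  have hcl : IsClopen {x : EE | x.1.1 = pp} := by
    constructor
    · exact isClosed_eq (by fun_prop) continuous_const
    · have : {x : EE | x.1.1 = pp} = {x : EE | x.1.2 ≠ 0} := by
        ext ⟨x, hx⟩
        rcases hx with ⟨h1, h2⟩ | ⟨h1, h2⟩ <;> simp [h1, h2]
      rw [this]
      exact isOpen_ne_fun (by fun_prop) continuous_const
  have hfc : FunctionallyClosed EE {x : EE | x.1.1 = pp} := by
    have := fc_of_cont (hcl.compl.continuous_indicator (f := fun _ => (1:ℝ)) continuous_const)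
    convert this using 1
    ext x
    simp [Set.indicator]
  obtain ⟨B, hB, hBE⟩ := hE.2 _ (FunMul.base _ hfc)
  obtain ⟨f, hf, h01, rfl⟩ := funMul_zero hB rfl
  have h1 : ∀ t : ℝ, t ≠ 0 → f (pp, t) = 0 := by
    intro t ht
    have : (pp, t) ∈ f ⁻¹' {0} ∩ EE := by
      rw [← hBE]
      exact ⟨⟨(pp, t), Or.inr ⟨rfl, ht⟩⟩, rfl, rfl⟩
    exact this.1
  obtain ⟨x, hx, h2⟩ := exists_ne_pp (fun n x => f (x, 1 / ((n:ℝ) + 1)))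
    (fun n => by fun_prop) (fun n => h1 _ (by positivity))
  have h3 : f (x, 0) = 0 := by
    have t1 : Filter.Tendsto (fun n : ℕ => f (x, 1 / ((n:ℝ) + 1))) Filter.atTop
        (nhds (f (x, 0))) :=
      (hf.tendsto _).comp
        (tendsto_const_nhds.prodMk_nhds tendsto_one_div_add_atTop_nhds_zero_nat)
    simp only [h2] at t1
    exact tendsto_nhds_unique t1 tendsto_const_nhds
  have h4 : (x, (0:ℝ)) ∈ f ⁻¹' {0} ∩ EE := ⟨h3, Or.inl ⟨hx, rfl⟩⟩
  rw [← hBE] at h4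
  obtain ⟨⟨y, hy⟩, hy1, rfl⟩ := h4
  exact hx hy1

/-- there are a completely regular space `X` and a subspace `E ⊆ X`
which is `1`-embedded but not `0`-embedded in `X`. -/
theorem stmt1 : ∃ (X : Type) (_ : TopologicalSpace X) (E : Set X),
    CompletelyRegularSpace X ∧ AlphaEmbedded 1 E ∧ ¬ AlphaEmbedded 0 E := by
  exact ⟨Ultrafilter ℕ × ℝ, inferInstance, EE, inferInstance, ⟨trace_add, trace_mul⟩, not_zero⟩
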